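/- arXiv:1101.5537 — 6 statements merged into one kernel-verified Lean document; each statement's English description precedes it below -/
import Mathlib

section
/- Let n ≥ 3 and let f : ZMod n → α be a proper coloring of the cycle graph on n vertices, i.e. f i ≠ f (i + 1) for all i ∈ ZMod n. If f attains at least 3 distinct values, then there exists i ∈ ZMod n such that f (i − 1), f i, f (i + 1) are pairwise distinct. -/
theorem stmt_2 {α : Type*} (n : ℕ) (hn : 3 ≤ n) (f : ZMod n → α)
    (hf : ∀ i, f i ≠ f (i + 1)) (h3 : 3 ≤ (Set.range f).ncard) :
    ∃ i : ZMod n, f (i - 1) ≠ f i ∧ f i ≠ f (i + 1) ∧ f (i - 1) ≠ f (i + 1) := by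
  by_contra hcon
  have hstep : ∀ i : ZMod n, f (i + 1 + 1) = f i := by
    intro i
    by_contra hne
    refine hcon ⟨i + 1, ?_, hf _, ?_⟩
    · rw [add_sub_cancel_right]; exact hf i
    · rw [add_sub_cancel_right]; exact fun h => hne h.symm
  have key : ∀ k : ℕ, (f (k : ZMod n) = f 0 ∧ f ((k : ZMod n) + 1) = f 1) ∨
      (f (k : ZMod n) = f 1 ∧ f ((k : ZMod n) + 1) = f 0) := by
    intro k
    induction k with
    | zero => left; simp
    | succ k ih =>
      push_cast
      rw [hstep]
      tauto
  have hsub : Set.range f ⊆ {f 0, f 1} := by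
    rintro _ ⟨x, rfl⟩
    haveI : NeZero n := ⟨by omega⟩
    have h := key x.val
    rw [ZMod.natCast_zmod_val] at h
    rcases h with h | h
    · left; exact h.1
    · right; exact h.1
  have h1 := Set.ncard_le_ncard hsub (Set.toFinite _)
  have h2 := Set.ncard_insert_le (f 0) {f 1}
  rw [Set.ncard_singleton] at h2
  omega
end

section
/- Let n ≥ 3 and let f : ZMod n → α be a proper coloring of the cycle graph on n vertices (f i ≠ f (i + 1) for all i) attaining at least 3 distinct values. Then there exists i ∈ ZMod n such that f (i − 1), f i, f (i + 1) are pairwise distinct and, moreover, either f j ≠ f i for all j ≠ i (the color of i is used only once), or the restriction of f to ZMod n \ {i} still attains at least 3 distinct values. -/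
theorem stmt_4 {α : Type*} (n : ℕ) (hn : 3 ≤ n) (f : ZMod n → α)
    (hf : ∀ i, f i ≠ f (i + 1)) (h3 : 3 ≤ (Set.range f).ncard) :
    ∃ i : ZMod n, (f (i - 1) ≠ f i ∧ f i ≠ f (i + 1) ∧ f (i - 1) ≠ f (i + 1)) ∧
      ((∀ j : ZMod n, j ≠ i → f j ≠ f i) ∨ 3 ≤ (f '' {j : ZMod n | j ≠ i}).ncard) := by
  have key : ∃ i : ZMod n, f (i - 1) ≠ f (i + 1) := by
    by_contra hcon
    have h : ∀ i : ZMod n, f (i - 1) = f (i + 1) := by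
      intro i
      by_contra hi
      exact hcon ⟨i, hi⟩
    have hk : ∀ k : ℕ, f (k : ZMod n) ∈ ({f 0, f 1} : Set α) ∧
        f ((k : ZMod n) + 1) ∈ ({f 0, f 1} : Set α) := by
      intro k
      induction k with
      | zero => simp
      | succ k ih =>
        have h2 := h ((k : ZMod n) + 1)
        rw [add_sub_cancel_right] at h2
        push_cast
        exact ⟨ih.2, h2 ▸ ih.1⟩
    have hsub : Set.range f ⊆ {f 0, f 1} := by
      rintro _ ⟨x, rfl⟩
      have : NeZero n := ⟨by omega⟩
      have := (hk x.val).1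
      rwa [ZMod.natCast_zmod_val] at this
    have h1 := Set.ncard_le_ncard hsub (Set.toFinite _)
    have h2 := Set.ncard_insert_le (f 0) {f 1}
    rw [Set.ncard_singleton] at h2
    omega
  obtain ⟨i, hi⟩ := key
  refine ⟨i, ⟨?_, hf i, hi⟩, ?_⟩
  · simpa using hf (i - 1)
  · by_cases hu : ∀ j : ZMod n, j ≠ i → f j ≠ f i
    · exact Or.inl hu
    · right
      push Not at hu
      obtain ⟨j, hj, hji⟩ := hu
      have : f '' {j : ZMod n | j ≠ i} = Set.range f := by
        apply Set.Subset.antisymm (Set.image_subset_range _ _)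
        rintro _ ⟨x, rfl⟩
        by_cases hx : x = i
        · exact ⟨j, hj, by rw [hx, hji]⟩
        · exact ⟨x, hx, rfl⟩
      rw [this]
      exact h3
end

section
/- Let n ≥ 3 and let f : ZMod n → Fin 3 be a proper coloring of the cycle graph on n vertices (f i ≠ f (i + 1) for all i). Suppose there is a vertex i₀ such that f j ≠ f i₀ for all j ≠ i₀ (the color of i₀ is used only once). Then the fan from i₀, namely the set D of diagonals {i₀, j} for j ∉ {i₀ − 1, i₀, i₀ + 1}, consists of exactly n − 3 diagonals, the diagonals in D are pairwise noncrossing, and every diagonal in D has endpoints of distinct colors. -/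
/-- The open cyclic arc from `a` to `b` in `ZMod n`: the points `a + k` for
`0 < k < m`, where `m` is the least positive integer with `a + m = b`
(namely `m = (b - a).val` when `a ≠ b`). -/
def openArc {n : ℕ} (a b : ZMod n) : Set (ZMod n) :=
  {x | ∃ k : ℕ, 0 < k ∧ k < (b - a).val ∧ x = a + (k : ZMod n)}

/-- Two unordered pairs (diagonals) cross: for some representations
`d₁ = {a, b}` and `d₂ = {c, d}`, `c` lies in the open arc `(a, b)` and
`d` lies in the open arc `(b, a)`. -/
def Crosses {n : ℕ} (d₁ d₂ : Sym2 (ZMod n)) : Prop :=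
  ∃ a b c d : ZMod n, d₁ = s(a, b) ∧ d₂ = s(c, d) ∧ c ∈ openArc a b ∧ d ∈ openArc b a

lemma openArc_left {n : ℕ} [NeZero n] (a b : ZMod n) : a ∉ openArc a b := by
  rintro ⟨k, h0, hk, h⟩
  have hkn : k < n := hk.trans (ZMod.val_lt _)
  have h1 : (k : ZMod n) = 0 := by simpa using h.symm
  have h2 := ZMod.val_cast_of_lt hkn
  rw [h1, ZMod.val_zero] at h2
  omega

lemma openArc_right {n : ℕ} [NeZero n] (a b : ZMod n) : b ∉ openArc a b := by
  rintro ⟨k, h0, hk, h⟩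
  have hkn : k < n := hk.trans (ZMod.val_lt _)
  have h1 : b - a = (k : ZMod n) := by rw [h]; ring
  rw [h1, ZMod.val_cast_of_lt hkn] at hk
  omega

theorem stmt_5 (n : ℕ) (hn : 3 ≤ n) (f : ZMod n → Fin 3)
    (hf : ∀ i, f i ≠ f (i + 1)) (i₀ : ZMod n) (hi₀ : ∀ j : ZMod n, j ≠ i₀ → f j ≠ f i₀)
    (D : Set (Sym2 (ZMod n)))
    (hD : D = {d | ∃ j : ZMod n, j ∉ ({i₀ - 1, i₀, i₀ + 1} : Set (ZMod n)) ∧ d = s(i₀, j)}) :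
    D.ncard = n - 3 ∧
    (∀ d₁ ∈ D, ∀ d₂ ∈ D, d₁ ≠ d₂ → ¬ Crosses d₁ d₂) ∧
    (∀ d ∈ D, ∀ a b : ZMod n, d = s(a, b) → f a ≠ f b) := by
  haveI : NeZero n := ⟨by omega⟩
  haveI : Fact (1 < n) := ⟨by omega⟩
  subst hD
  refine ⟨?_, ?_, ?_⟩
  · have himg : {d | ∃ j : ZMod n, j ∉ ({i₀ - 1, i₀, i₀ + 1} : Set (ZMod n)) ∧ d = s(i₀, j)}
        = (fun j => s(i₀, j)) '' (({i₀ - 1, i₀, i₀ + 1} : Set (ZMod n))ᶜ) := by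
      ext d
      simp only [Set.mem_setOf_eq, Set.mem_image, Set.mem_compl_iff, eq_comm]
    have hinj : Function.Injective (fun j : ZMod n => s(i₀, j)) := by
      intro x y h
      exact Sym2.congr_right.mp h
    have h2 : (2 : ZMod n) ≠ 0 := by
      intro h
      have := ZMod.val_cast_of_lt (show 2 < n by omega)
      rw [Nat.cast_ofNat, h, ZMod.val_zero] at this
      omega
    have hcard : ({i₀ - 1, i₀, i₀ + 1} : Set (ZMod n)).ncard = 3 := by
      rw [Set.ncard_eq_three]
      refine ⟨_, _, _, ?_, ?_, ?_, rfl⟩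
      · simp
      · intro h
        apply h2
        linear_combination -h
      · simp
    rw [himg, Set.ncard_image_of_injective _ hinj, Set.ncard_compl, hcard, Nat.card_zmod]
  · rintro d₁ ⟨j, hj, rfl⟩ d₂ ⟨k, hk, rfl⟩ - ⟨a, b, c, d, h1, h2, hc, hd⟩
    have e1 : i₀ = a ∨ i₀ = b := by
      have : i₀ ∈ s(a, b) := h1 ▸ Sym2.mem_mk_left i₀ j
      simpa using this
    have e2 : i₀ = c ∨ i₀ = d := by
      have : i₀ ∈ s(c, d) := h2 ▸ Sym2.mem_mk_left i₀ k
      simpa using this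
    rcases e2 with rfl | rfl <;> rcases e1 with rfl | rfl
    · exact openArc_left _ _ hc
    · exact openArc_right _ _ hc
    · exact openArc_right _ _ hd
    · exact openArc_left _ _ hd
  · rintro d ⟨j, hj, rfl⟩ a b h
    have hji : j ≠ i₀ := by
      rintro rfl
      simp at hj
    rw [Sym2.eq_iff] at h
    rcases h with ⟨rfl, rfl⟩ | ⟨rfl, rfl⟩
    · exact (hi₀ _ hji).symm
    · exact hi₀ _ hji
end

section
/- (Combinatorial form of Lemma 2.) Let n ≥ 3 and let f : ZMod n → Fin 3 be a proper coloring of the cycle graph on n vertices (f i ≠ f (i + 1) for all i) that is surjective onto Fin 3 (uses all three colors). Then there exists a set D of diagonals of the n-gon such that: D has exactly n − 3 elements, the diagonals in D are pairwise noncrossing, and every diagonal {a, b} ∈ D satisfies f a ≠ f b. (Such a maximal family of pairwise noncrossing diagonals subdivides the n-gon into triangles, giving a triangulation of the 2-disk with boundary the given cycle, no inner vertices, and on which f remains a proper 3-coloring.) -/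
/-- An unordered pair `{a, b}` of elements of `ZMod n` is a diagonal of the
`n`-gon if `b ∉ {a - 1, a, a + 1}`. -/
def IsDiagonal {n : ℕ} (d : Sym2 (ZMod n)) : Prop :=
  ∃ a b : ZMod n, d = s(a, b) ∧ b ∉ ({a - 1, a, a + 1} : Set (ZMod n))

/-- Color arithmetic: in `Fin 3`, two elements avoiding the same two distinct values agree. -/
lemma fin3_eq (x y u v : Fin 3) (huv : u ≠ v) (h1 : x ≠ u) (h2 : x ≠ v) (h3 : y ≠ u)
    (h4 : y ≠ v) : x = y := by omega

/-- Cyclic successor on `{0, …, m-1}`. -/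
def nx (m i : ℕ) : ℕ := if i + 1 = m then 0 else i + 1

/-- Cyclic predecessor on `{0, …, m-1}`. -/
def pv (m i : ℕ) : ℕ := if i = 0 then m - 1 else i - 1

/-- The increasing map skipping `j`. -/
def skip (j k : ℕ) : ℕ := if k < j then k else k + 1

lemma exists_ear0 (m : ℕ) (hm : 3 ≤ m) (f : ℕ → Fin 3)
    (hs : ∀ c, ∃ i < m, f i = c) : ∃ j < m, f (pv m j) ≠ f (nx m j) := by
  by_contra! h
  have h2 : ∀ i, i + 2 < m → f (i + 2) = f i := by
    intro i hi
    have := h (i + 1) (by omega)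
    simp only [pv, nx] at this
    rw [if_neg (by omega), if_neg (by omega)] at this
    simpa using this.symm
  have key : ∀ k, k < m → f k = f 0 ∨ f k = f 1 := by
    intro k
    induction k using Nat.strong_induction_on with
    | _ k ih =>
      intro hk
      match k, ih, hk with
      | 0, _, _ => exact Or.inl rfl
      | 1, _, _ => exact Or.inr rfl
      | k + 2, ih, hk =>
        rw [h2 k hk]
        exact ih k (by omega) (by omega)
  obtain ⟨c, hc0, hc1⟩ : ∃ c : Fin 3, c ≠ f 0 ∧ c ≠ f 1 := by
    generalize f 0 = x
    generalize f 1 = y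
    revert x y
    decide
  obtain ⟨i, hi, rfl⟩ := hs c
  rcases key i hi with h | h
  · exact hc0 h
  · exact hc1 h

lemma exists_ear (m : ℕ) (hm : 4 ≤ m) (f : ℕ → Fin 3)
    (hf : ∀ i < m, f i ≠ f (nx m i))
    (hs : ∀ c, ∃ i < m, f i = c) :
    ∃ j < m, f (pv m j) ≠ f (nx m j) ∧ ∃ k < m, k ≠ j ∧ f k = f j := by
  obtain ⟨i, hi, hne⟩ := exists_ear0 m (by omega) f hs
  by_cases hu : ∃ k < m, k ≠ i ∧ f k = f i
  · exact ⟨i, hi, hne, hu⟩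
  · push Not at hu
    have hpn : pv m (nx m i) = i := by unfold pv nx; grind
    have hnp : nx m (pv m i) = i := by unfold pv nx; grind
    have hnpp : nx m (pv m (pv m i)) = pv m i := by unfold pv nx; grind
    have l1 : nx m i < m := by unfold nx; grind
    have l2 : nx m (nx m i) < m := by unfold nx; grind
    have l3 : pv m i < m := by unfold pv; grind
    have l4 : pv m (pv m i) < m := by unfold pv; grind
    have n1 : nx m (nx m i) ≠ i := by unfold nx; grind
    have n2 : pv m (pv m i) ≠ i := by unfold pv; grind
    have n3 : pv m (pv m i) ≠ nx m i := by unfold pv nx; grind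
    refine ⟨nx m i, l1, ?_, pv m (pv m i), l4, n3, ?_⟩
    · rw [hpn]; exact (hu _ l2 n1).symm
    · have e1 := hf _ l3
      have e2 := hf _ l4
      have e3 := hf _ hi
      rw [hnp] at e1
      rw [hnpp] at e2
      exact fin3_eq _ _ (f (pv m i)) (f i) e1 e2 (hu _ l4 n2) hne.symm e3.symm

lemma linear_version (m : ℕ) (hm : 3 ≤ m) : ∀ (f : ℕ → Fin 3)
    (_ : ∀ i < m, f i ≠ f (nx m i)) (_ : ∀ c, ∃ i < m, f i = c),
    ∃ D : Finset (ℕ × ℕ), D.card = m - 3 ∧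
      (∀ p ∈ D, p.1 + 2 ≤ p.2 ∧ p.2 < m ∧ ¬ (p.1 = 0 ∧ p.2 + 1 = m) ∧ f p.1 ≠ f p.2) ∧
      (∀ p ∈ D, ∀ q ∈ D, ¬ (p.1 < q.1 ∧ q.1 < p.2 ∧ p.2 < q.2)) := by
  induction m, hm using Nat.le_induction with
  | base => intro f _ _; exact ⟨∅, by simp⟩
  | succ m hm ih =>
    intro f hf hs
    obtain ⟨j, hj, hne, k, hk, hkj, hfk⟩ := exists_ear (m + 1) (by omega) f hf hs
    have hsk : ∀ i, i < m + 1 → i ≠ j → ∃ i' < m, skip j i' = i := by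
      intro i hi hij
      by_cases h : i < j
      · exact ⟨i, by omega, by simp [skip, h]⟩
      · exact ⟨i - 1, by omega, by unfold skip; split_ifs <;> omega⟩
    obtain ⟨D, hc, hd, hx⟩ := ih (fun i => f (skip j i)) (by
      intro i hi
      by_cases h : nx (m + 1) (skip j i) = j
      · have e1 : skip j i = pv (m + 1) j := by
          revert h; unfold nx pv skip; grind
        have e2 : skip j (nx m i) = nx (m + 1) j := by
          revert h; unfold nx skip; grind
        simp only [e1, e2]
        exact hne
      · have e2 : skip j (nx m i) = nx (m + 1) (skip j i) := by
          revert h; unfold nx skip; grind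
        simp only [e2]
        exact hf _ (by unfold skip; split_ifs <;> omega)) (by
      intro c
      obtain ⟨i, hi, rfl⟩ := hs c
      by_cases hij : i = j
      · subst hij
        obtain ⟨i', h1, h2⟩ := hsk k hk hkj
        exact ⟨i', h1, by simp only [h2, hfk]⟩
      · obtain ⟨i', h1, h2⟩ := hsk i hi hij
        exact ⟨i', h1, by simp only [h2]⟩)
    obtain ⟨x, y, hxy, hfe⟩ : ∃ x y : ℕ,
        ((j = 0 ∧ x = 1 ∧ y = m) ∨ (j = m ∧ x = 0 ∧ y + 1 = m) ∨
          (0 < j ∧ j < m ∧ x + 1 = j ∧ y = j + 1)) ∧ f x ≠ f y := by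
      by_cases h0 : j = 0
      · refine ⟨1, m, by omega, ?_⟩
        subst h0
        have : ¬ (0 + 1 = m + 1) := by omega
        simp only [pv, nx, this, if_false, if_true] at hne
        simpa using hne.symm
      · by_cases h1 : j = m
        · refine ⟨0, m - 1, by omega, ?_⟩
          subst h1
          simp only [pv, nx, h0, if_false, if_true] at hne
          exact hne.symm
        · refine ⟨j - 1, j + 1, by omega, ?_⟩
          simpa [pv, nx, h0, h1] using hne
    have hinj : Function.Injective (fun p : ℕ × ℕ => (skip j p.1, skip j p.2)) := by
      rintro ⟨a, b⟩ ⟨c, d⟩ h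
      simp only [Prod.mk.injEq, skip] at h ⊢
      obtain ⟨h1, h2⟩ := h
      constructor
      · split_ifs at h1 <;> omega
      · split_ifs at h2 <;> omega
    have hnot : (x, y) ∉ D.image (fun p : ℕ × ℕ => (skip j p.1, skip j p.2)) := by
      simp only [Finset.mem_image, Prod.mk.injEq, not_exists, not_and]
      rintro ⟨a, b⟩ hab h1 h2
      obtain ⟨q1, q2, q3, -⟩ := hd _ hab
      simp only [skip] at h1 h2 q1 q2 q3
      split_ifs at h1 h2 <;> omega
    refine ⟨insert (x, y) (D.image (fun p : ℕ × ℕ => (skip j p.1, skip j p.2))), ?_, ?_, ?_⟩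
    · rw [Finset.card_insert_of_notMem hnot, Finset.card_image_of_injective _ hinj, hc]
      omega
    · intro p hp
      rw [Finset.mem_insert, Finset.mem_image] at hp
      rcases hp with rfl | ⟨⟨a, b⟩, hab, rfl⟩
      · exact ⟨by simp only; omega, by simp only; omega, by simp only; omega, hfe⟩
      · obtain ⟨q1, q2, q3, q4⟩ := hd _ hab
        simp only at q1 q2 q3
        refine ⟨?_, ?_, ?_, q4⟩
        · simp only [skip]; split_ifs <;> omega
        · simp only [skip]; split_ifs <;> omega
        · rintro ⟨r1, r2⟩
          simp only [skip] at r1 r2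
          split_ifs at r1 r2 <;> omega
    · intro p hp q hq
      rw [Finset.mem_insert, Finset.mem_image] at hp hq
      rcases hp with rfl | ⟨⟨a, b⟩, hab, rfl⟩ <;> rcases hq with rfl | ⟨⟨c, d⟩, hcd, rfl⟩
      · simp only; omega
      · obtain ⟨q1, q2, q3, -⟩ := hd _ hcd
        simp only [skip] at *
        split_ifs <;> omega
      · obtain ⟨q1, q2, q3, -⟩ := hd _ hab
        simp only [skip] at *
        split_ifs <;> omega
      · have := hx _ hab _ hcd
        simp only [skip] at *
        split_ifs <;> omega

lemma openArc_val {n : ℕ} [NeZero n] (a b c : ZMod n) (h : c ∈ openArc a b) :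
    (a.val < b.val ∧ a.val < c.val ∧ c.val < b.val) ∨
      (b.val < a.val ∧ (a.val < c.val ∨ c.val < b.val)) := by
  obtain ⟨k, hk0, hk, rfl⟩ := h
  have ha := ZMod.val_lt a
  have hb := ZMod.val_lt b
  have hba := ZMod.val_lt (b - a)
  have hkv : ((k : ZMod n)).val = k := ZMod.val_cast_of_lt (by omega)
  have h1 : b.val = (a.val + (b - a).val) % n := by
    rw [← ZMod.val_add]; congr 1; ring
  have h2 : (a + (k : ZMod n)).val = (a.val + k) % n := by
    rw [ZMod.val_add, hkv]
  rw [h2]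
  have hm : ∀ t, t < 2 * n → t % n = if t < n then t else t - n := by
    intro t ht
    split_ifs with h
    · exact Nat.mod_eq_of_lt h
    · rw [Nat.mod_eq_sub_mod (by omega)]
      exact Nat.mod_eq_of_lt (by omega)
  rw [hm _ (by omega)] at h1 ⊢
  split_ifs at h1 ⊢ <;> omega

theorem stmt_6 (n : ℕ) (hn : 3 ≤ n) (f : ZMod n → Fin 3)
    (hf : ∀ i, f i ≠ f (i + 1)) (hsurj : Function.Surjective f) :
    ∃ D : Set (Sym2 (ZMod n)),
      (∀ d ∈ D, IsDiagonal d) ∧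
      D.ncard = n - 3 ∧
      (∀ d₁ ∈ D, ∀ d₂ ∈ D, d₁ ≠ d₂ → ¬ Crosses d₁ d₂) ∧
      (∀ d ∈ D, ∀ a b : ZMod n, d = s(a, b) → f a ≠ f b) := by
  haveI : NeZero n := ⟨by omega⟩
  obtain ⟨D, hc, hd, hx⟩ := linear_version n hn (fun i => f (i : ZMod n)) (by
    intro i hi
    have : ((nx n i : ℕ) : ZMod n) = (i : ZMod n) + 1 := by
      unfold nx
      split_ifs with h
      · have : ((i + 1 : ℕ) : ZMod n) = 0 := by rw [h]; simp
        push_cast at this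
        simp [this]
      · push_cast; rfl
    simp only [this]
    exact hf _) (by
    intro c
    obtain ⟨i, rfl⟩ := hsurj c
    exact ⟨i.val, ZMod.val_lt i, by simp⟩)
  have hval : ∀ k : ℕ, k < n → ((k : ZMod n)).val = k := fun k hk => ZMod.val_cast_of_lt hk
  have hrep : ∀ p ∈ D, ∀ a b : ZMod n, s((p.1 : ZMod n), (p.2 : ZMod n)) = s(a, b) →
      (a.val = p.1 ∧ b.val = p.2) ∨ (a.val = p.2 ∧ b.val = p.1) := by
    intro p hp a b h
    obtain ⟨q1, q2, -, -⟩ := hd p hp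
    rw [Sym2.eq_iff] at h
    rcases h with ⟨rfl, rfl⟩ | ⟨rfl, rfl⟩
    · exact Or.inl ⟨hval _ (by omega), hval _ q2⟩
    · exact Or.inr ⟨hval _ q2, hval _ (by omega)⟩
  refine ⟨(fun p : ℕ × ℕ => s((p.1 : ZMod n), (p.2 : ZMod n))) '' (D : Set (ℕ × ℕ)),
    ?_, ?_, ?_, ?_⟩
  · rintro _ ⟨p, hp, rfl⟩
    obtain ⟨q1, q2, q3, -⟩ := hd p hp
    refine ⟨_, _, rfl, ?_⟩
    simp only [Set.mem_insert_iff, Set.mem_singleton_iff, not_or]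
    refine ⟨?_, ?_, ?_⟩
    · intro h
      have h' : ((p.2 + 1 : ℕ) : ZMod n) = (p.1 : ZMod n) := by
        push_cast; rw [h]; ring
      have h'' := congrArg ZMod.val h'
      rw [hval p.1 (by omega)] at h''
      by_cases e : p.2 + 1 = n
      · rw [e, ZMod.natCast_self, ZMod.val_zero] at h''
        omega
      · rw [hval _ (by omega)] at h''
        omega
    · intro h
      have h'' := congrArg ZMod.val h
      rw [hval p.1 (by omega), hval p.2 (by omega)] at h''
      omega
    · intro h
      have h' : (p.2 : ZMod n) = ((p.1 + 1 : ℕ) : ZMod n) := by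
        push_cast; rw [h]
      have h'' := congrArg ZMod.val h'
      rw [hval p.2 (by omega), hval (p.1 + 1) (by omega)] at h''
      omega
  · rw [Set.ncard_image_of_injOn, Set.ncard_coe_finset, hc]
    intro p hp q hq h
    have hp' := hd p hp
    have hq' := hd q hq
    have := hrep p hp _ _ h
    rw [hval q.1 (by omega), hval q.2 (by omega)] at this
    ext <;> omega
  · rintro _ ⟨p, hp, rfl⟩ _ ⟨q, hq, rfl⟩ - ⟨a, b, c, d, h1, h2, h3, h4⟩
    have e1 := hrep p hp _ _ h1
    have e2 := hrep q hq _ _ h2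
    have o1 := openArc_val _ _ _ h3
    have o2 := openArc_val _ _ _ h4
    have x1 := hx p hp q hq
    have x2 := hx q hq p hp
    have hp' := hd p hp
    have hq' := hd q hq
    omega
  · rintro _ ⟨p, hp, rfl⟩ a b h
    obtain ⟨-, -, -, q⟩ := hd p hp
    rw [Sym2.eq_iff] at h
    rcases h with ⟨rfl, rfl⟩ | ⟨rfl, rfl⟩
    · exact q
    · exact q.symm
end

section
/- Let n ≥ 3 and let p : ZMod n → ℝ² be the vertices of the regular n-gon, p k = (cos(2πk/n), sin(2πk/n)). Then the fan triangulation from p 0, i.e. the collection of all subsets of the triangles {p 0, p i, p (i+1)} for integers 1 ≤ i ≤ n − 2, is a simplicial complex in ℝ² (in the sense of Mathlib's Geometry.SimplicialComplex) whose underlying space equals the convex hull of {p k : k ∈ ZMod n}. -/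
open scoped Classical

/-- The vertices of the regular `n`-gon in the plane:
`p k = (cos (2πk/n), sin (2πk/n))` for `k : ZMod n`. -/
noncomputable def ngon (n : ℕ) (k : ZMod n) : ℝ × ℝ :=
  (Real.cos (2 * Real.pi * (k.val : ℝ) / (n : ℝ)),
   Real.sin (2 * Real.pi * (k.val : ℝ) / (n : ℝ)))

/-- Twice the signed area of the triangle `a b c`. -/
def orient (a b c : ℝ × ℝ) : ℝ :=
  (b.1 - a.1) * (c.2 - a.2) - (b.2 - a.2) * (c.1 - a.1)

lemma orient_comb (a b : ℝ × ℝ) (s : Finset (ℝ × ℝ)) (w : ℝ × ℝ → ℝ) (h1 : ∑ y ∈ s, w y = 1) :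
    orient a b (∑ y ∈ s, w y • y) = ∑ y ∈ s, w y * orient a b y := by
  have e : ∀ y : ℝ × ℝ, w y * orient a b y = (b.1 - a.1) * (w y * y.2)
      - (b.2 - a.2) * (w y * y.1) + w y * ((b.2 - a.2) * a.1 - (b.1 - a.1) * a.2) := by
    intro y; unfold orient; ring
  simp only [e, Finset.sum_add_distrib, Finset.sum_sub_distrib, ← Finset.mul_sum,
    ← Finset.sum_mul, h1]
  unfold orient
  simp only [Prod.fst_sum, Prod.snd_sum, Prod.smul_fst, Prod.smul_snd, smul_eq_mul]
  ring

lemma orient_nonneg_hull (a b : ℝ × ℝ) (s : Finset (ℝ × ℝ)) (hs : ∀ y ∈ s, 0 ≤ orient a b y)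
    {x : ℝ × ℝ} (hx : x ∈ convexHull ℝ (s : Set (ℝ × ℝ))) : 0 ≤ orient a b x := by
  rw [Finset.mem_convexHull'] at hx
  obtain ⟨w, h0, h1, rfl⟩ := hx
  rw [orient_comb a b s w h1]
  exact Finset.sum_nonneg fun y hy => mul_nonneg (h0 y hy) (hs y hy)

lemma orient_nonpos_hull (a b : ℝ × ℝ) (s : Finset (ℝ × ℝ)) (hs : ∀ y ∈ s, orient a b y ≤ 0)
    {x : ℝ × ℝ} (hx : x ∈ convexHull ℝ (s : Set (ℝ × ℝ))) : orient a b x ≤ 0 := by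
  rw [Finset.mem_convexHull'] at hx
  obtain ⟨w, h0, h1, rfl⟩ := hx
  rw [orient_comb a b s w h1]
  exact Finset.sum_nonpos fun y hy => mul_nonpos_of_nonneg_of_nonpos (h0 y hy) (hs y hy)

lemma hull_restrict (s : Finset (ℝ × ℝ)) (w : ℝ × ℝ → ℝ) (P : ℝ × ℝ → Prop)
    (h0 : ∀ y ∈ s, 0 ≤ w y) (h1 : ∑ y ∈ s, w y = 1) (hP : ∀ y ∈ s, ¬ P y → w y = 0) :
    ∑ y ∈ s, w y • y ∈ convexHull ℝ ((s.filter P : Finset (ℝ × ℝ)) : Set (ℝ × ℝ)) := by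
  rw [Finset.mem_convexHull']
  refine ⟨w, fun y hy => h0 y (Finset.mem_filter.1 hy).1, ?_, ?_⟩
  · rw [← h1]
    refine Finset.sum_subset (Finset.filter_subset _ _) fun y hy hn => hP y hy fun h => hn ?_
    exact Finset.mem_filter.2 ⟨hy, h⟩
  · refine Finset.sum_subset (Finset.filter_subset _ _) fun y hy hn => ?_
    rw [hP y hy fun h => hn (Finset.mem_filter.2 ⟨hy, h⟩), zero_smul]

lemma face_nonneg (a b : ℝ × ℝ) (s : Finset (ℝ × ℝ)) (hs : ∀ y ∈ s, 0 ≤ orient a b y)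
    {x : ℝ × ℝ} (hx : x ∈ convexHull ℝ (s : Set (ℝ × ℝ))) (hx0 : orient a b x = 0) :
    x ∈ convexHull ℝ ((s.filter (fun y => orient a b y = 0) : Finset (ℝ × ℝ)) :
      Set (ℝ × ℝ)) := by
  rw [Finset.mem_convexHull'] at hx
  obtain ⟨w, h0, h1, rfl⟩ := hx
  rw [orient_comb a b s w h1, Finset.sum_eq_zero_iff_of_nonneg
    (fun y hy => mul_nonneg (h0 y hy) (hs y hy))] at hx0
  exact hull_restrict s w _ h0 h1 fun y hy hn => (mul_eq_zero.1 (hx0 y hy)).resolve_right hn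

lemma face_nonpos (a b : ℝ × ℝ) (s : Finset (ℝ × ℝ)) (hs : ∀ y ∈ s, orient a b y ≤ 0)
    {x : ℝ × ℝ} (hx : x ∈ convexHull ℝ (s : Set (ℝ × ℝ))) (hx0 : orient a b x = 0) :
    x ∈ convexHull ℝ ((s.filter (fun y => orient a b y = 0) : Finset (ℝ × ℝ)) :
      Set (ℝ × ℝ)) := by
  rw [Finset.mem_convexHull'] at hx
  obtain ⟨w, h0, h1, rfl⟩ := hx
  rw [orient_comb a b s w h1, Finset.sum_eq_zero_iff_of_nonpos
    (fun y hy => mul_nonpos_of_nonneg_of_nonpos (h0 y hy) (hs y hy))] at hx0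
  exact hull_restrict s w _ h0 h1 fun y hy hn => (mul_eq_zero.1 (hx0 y hy)).resolve_right hn

lemma indep_triangle (a b c : ℝ × ℝ) (h : orient a b c ≠ 0) :
    AffineIndependent ℝ ((↑) : ({a, b, c} : Finset (ℝ × ℝ)) → ℝ × ℝ) := by
  have h3 : AffineIndependent ℝ ![a, b, c] := by
    rw [affineIndependent_iff_not_collinear_set, collinear_iff_of_mem (p₀ := a) (by simp)]
    rintro ⟨v, hv⟩
    obtain ⟨r, hr⟩ := hv b (by simp)
    obtain ⟨t, ht⟩ := hv c (by simp)
    apply h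
    rw [hr, ht]
    simp only [orient, vadd_eq_add, Prod.fst_add, Prod.snd_add, Prod.smul_fst, Prod.smul_snd,
      smul_eq_mul]
    ring
  have h4 := h3.range
  have e : Set.range ![a, b, c] = (({a, b, c} : Finset (ℝ × ℝ)) : Set (ℝ × ℝ)) := by
    ext y
    simp [eq_comm]
    tauto
  rw [e] at h4
  exact h4

lemma mem_triangle (a b c x : ℝ × ℝ) (h : 0 < orient a b c) (h1 : 0 ≤ orient a b x)
    (h2 : orient a c x ≤ 0) (h3 : 0 ≤ orient b c x) :
    x ∈ convexHull ℝ ((({a, b, c} : Finset (ℝ × ℝ))) : Set (ℝ × ℝ)) := by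
  have hconv := convex_convexHull ℝ ((({a, b, c} : Finset (ℝ × ℝ))) : Set (ℝ × ℝ))
  have hsub := subset_convexHull ℝ ((({a, b, c} : Finset (ℝ × ℝ))) : Set (ℝ × ℝ))
  have key := hconv.sum_mem (t := Finset.univ)
    (w := ![orient b c x / orient a b c, -orient a c x / orient a b c,
      orient a b x / orient a b c]) (z := ![a, b, c]) ?_ ?_ ?_
  · convert key using 1
    simp only [Fin.sum_univ_three, Matrix.cons_val_zero, Matrix.cons_val_one, Matrix.cons_val]
    ext
    · simp only [Prod.fst_add, Prod.smul_fst, smul_eq_mul]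
      field_simp
      simp only [orient]; ring
    · simp only [Prod.snd_add, Prod.smul_snd, smul_eq_mul]
      field_simp
      simp only [orient]; ring
  · intro i _
    fin_cases i
    · exact div_nonneg h3 h.le
    · exact div_nonneg (by linarith) h.le
    · exact div_nonneg h1 h.le
  · simp only [Fin.sum_univ_three, Matrix.cons_val_zero, Matrix.cons_val_one, Matrix.cons_val]
    field_simp
    simp only [orient]; ring
  · intro i _
    apply hsub
    fin_cases i <;> simp

lemma orient_self_left (a b : ℝ × ℝ) : orient a b a = 0 := by simp [orient]
lemma orient_self_right (a b : ℝ × ℝ) : orient a b b = 0 := by unfold orient; ring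
lemma orient_swap (a b c : ℝ × ℝ) : orient a c b = - orient a b c := by unfold orient; ring
lemma orient_rot (a b c : ℝ × ℝ) : orient b c a = orient a b c := by unfold orient; ring

section fan
variable (n : ℕ) (q : ℕ → ℝ × ℝ)
  (hq : ∀ a b c, a < b → b < c → c < n → 0 < orient (q a) (q b) (q c))

lemma fan_inter_lt (hq : ∀ a b c, a < b → b < c → c < n → 0 < orient (q a) (q b) (q c))
    (i j : ℕ) (hi : 1 ≤ i) (hij : i < j) (hj : j + 1 < n)
    (s t : Finset (ℝ × ℝ)) (hs : s ⊆ {q 0, q i, q (i + 1)}) (ht : t ⊆ {q 0, q j, q (j + 1)}) :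
    convexHull ℝ (s : Set (ℝ × ℝ)) ∩ convexHull ℝ (t : Set (ℝ × ℝ)) ⊆
      convexHull ℝ ((s : Set (ℝ × ℝ)) ∩ t) := by
  rintro x ⟨hxs, hxt⟩
  have hi0 : orient (q 0) (q (i + 1)) (q i) < 0 := by
    rw [orient_swap]; linarith [hq 0 i (i + 1) (by omega) (by omega) (by omega)]
  have hs' : ∀ y ∈ s, orient (q 0) (q (i + 1)) y ≤ 0 := by
    intro y hy
    have := hs hy
    simp only [Finset.mem_insert, Finset.mem_singleton] at this
    rcases this with rfl | rfl | rfl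
    · rw [orient_self_left]
    · exact hi0.le
    · rw [orient_self_right]
  have hjj : 0 < orient (q 0) (q (i + 1)) (q (j + 1)) :=
    hq 0 (i + 1) (j + 1) (by omega) (by omega) (by omega)
  have hj0 : j = i + 1 ∨ 0 < orient (q 0) (q (i + 1)) (q j) := by
    rcases Nat.lt_or_ge (i + 1) j with h | h
    · exact Or.inr (hq 0 (i + 1) j (by omega) h (by omega))
    · left; omega
  have ht' : ∀ y ∈ t, 0 ≤ orient (q 0) (q (i + 1)) y := by
    intro y hy
    have := ht hy
    simp only [Finset.mem_insert, Finset.mem_singleton] at this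
    rcases this with rfl | rfl | rfl
    · rw [orient_self_left]
    · rcases hj0 with h | h
      · rw [h, orient_self_right]
      · exact h.le
    · exact hjj.le
  have hx0 := le_antisymm (orient_nonpos_hull _ _ s hs' hxs) (orient_nonneg_hull _ _ t ht' hxt)
  have h1 := face_nonpos _ _ s hs' hxs hx0
  have h2 := face_nonneg _ _ t ht' hxt hx0
  have hind := indep_triangle (q 0) (q i) (q (i + 1))
    (hq 0 i (i + 1) (by omega) (by omega) (by omega)).ne'
  have hsub1 : s.filter (fun y => orient (q 0) (q (i + 1)) y = 0) ⊆ {q 0, q i, q (i + 1)} :=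
    (Finset.filter_subset _ _).trans hs
  have hsub2 : t.filter (fun y => orient (q 0) (q (i + 1)) y = 0) ⊆ {q 0, q i, q (i + 1)} := by
    intro y hy
    rw [Finset.mem_filter] at hy
    have := ht hy.1
    simp only [Finset.mem_insert, Finset.mem_singleton] at this ⊢
    rcases this with rfl | rfl | rfl
    · simp
    · rcases hj0 with h | h
      · simp [h]
      · exact absurd hy.2 h.ne'
    · exact absurd hy.2 hjj.ne'
  have h3 := hind.convexHull_inter hsub1 hsub2
  have h4 := h3.ge (Set.mem_inter h1 h2)
  refine convexHull_mono ?_ h4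
  intro y hy
  simp only [Finset.coe_filter, Set.mem_inter_iff, Set.mem_ofPred_eq] at hy
  exact ⟨hy.1.1, hy.2.1⟩

lemma fan_inter (hq : ∀ a b c, a < b → b < c → c < n → 0 < orient (q a) (q b) (q c))
    (i j : ℕ) (hi : 1 ≤ i) (hi' : i + 1 < n) (hj0 : 1 ≤ j) (hj : j + 1 < n)
    (s t : Finset (ℝ × ℝ)) (hs : s ⊆ {q 0, q i, q (i + 1)}) (ht : t ⊆ {q 0, q j, q (j + 1)}) :
    convexHull ℝ (s : Set (ℝ × ℝ)) ∩ convexHull ℝ (t : Set (ℝ × ℝ)) ⊆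
      convexHull ℝ ((s : Set (ℝ × ℝ)) ∩ t) := by
  rcases lt_trichotomy i j with h | rfl | h
  · exact fan_inter_lt n q hq i j hi h hj s t hs ht
  · have hind := indep_triangle (q 0) (q i) (q (i + 1))
      (hq 0 i (i + 1) (by omega) (by omega) (by omega)).ne'
    exact (hind.convexHull_inter hs ht).ge
  · rw [Set.inter_comm, Set.inter_comm (s : Set (ℝ × ℝ))]
    exact fan_inter_lt n q hq j i hj0 h hi' t s ht hs

lemma fan_cover (hn : 3 ≤ n)
    (hq : ∀ a b c, a < b → b < c → c < n → 0 < orient (q a) (q b) (q c))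
    (x : ℝ × ℝ)
    (hx : x ∈ convexHull ℝ ((((Finset.range n).image q : Finset (ℝ × ℝ))) : Set (ℝ × ℝ))) :
    ∃ i, 1 ≤ i ∧ i + 1 < n ∧
      x ∈ convexHull ℝ ((({q 0, q i, q (i + 1)} : Finset (ℝ × ℝ))) : Set (ℝ × ℝ)) := by
  have edge : ∀ i, i + 1 < n → 0 ≤ orient (q i) (q (i + 1)) x := by
    intro i hi
    refine orient_nonneg_hull _ _ _ ?_ hx
    intro y hy
    obtain ⟨k, hk, rfl⟩ := Finset.mem_image.1 hy
    rw [Finset.mem_range] at hk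
    rcases lt_trichotomy k i with h | rfl | h
    · rw [orient_rot]; exact (hq k i (i + 1) h (by omega) hi).le
    · rw [orient_self_left]
    · rcases Nat.lt_or_ge (i + 1) k with h' | h'
      · exact (hq i (i + 1) k (by omega) h' hk).le
      · obtain rfl : k = i + 1 := by omega
        rw [orient_self_right]
  have last : orient (q 0) (q (n - 1)) x ≤ 0 := by
    refine orient_nonpos_hull _ _ _ ?_ hx
    intro y hy
    obtain ⟨k, hk, rfl⟩ := Finset.mem_image.1 hy
    rw [Finset.mem_range] at hk
    rcases Nat.eq_zero_or_pos k with rfl | h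
    · rw [orient_self_left]
    · rcases Nat.lt_or_ge k (n - 1) with h' | h'
      · rw [orient_swap]; linarith [hq 0 k (n - 1) h h' (by omega)]
      · obtain rfl : k = n - 1 := by omega
        rw [orient_self_right]
  have ex : ∃ m, orient (q 0) (q (m + 2)) x ≤ 0 := ⟨n - 3, by
    rwa [show n - 3 + 2 = n - 1 by omega]⟩
  have hm := Nat.find_spec ex
  have hle : Nat.find ex ≤ n - 3 := Nat.find_min' ex (by
    rwa [show n - 3 + 2 = n - 1 by omega])
  have hmin : ∀ k, k < Nat.find ex → 0 < orient (q 0) (q (k + 2)) x := fun k hk =>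
    not_le.1 (Nat.find_min ex hk)
  generalize Nat.find ex = m at hm hle hmin
  refine ⟨m + 1, by omega, by omega, mem_triangle _ _ _ _
    (hq 0 (m + 1) (m + 1 + 1) (by omega) (by omega) (by omega)) ?_ hm (edge (m + 1) (by omega))⟩
  rcases m with _ | k
  · exact edge 0 (by omega)
  · exact (hmin k (by omega)).le

end fan

/-- The vertices of the regular polygon indexed by naturals. -/
noncomputable def gonNat (n k : ℕ) : ℝ × ℝ :=
  (Real.cos (2 * Real.pi * (k : ℝ) / (n : ℝ)), Real.sin (2 * Real.pi * (k : ℝ) / (n : ℝ)))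

lemma orient_circle (α u v : ℝ) :
    orient (Real.cos α, Real.sin α) (Real.cos (α + 2 * u), Real.sin (α + 2 * u))
      (Real.cos (α + 2 * u + 2 * v), Real.sin (α + 2 * u + 2 * v)) =
      4 * Real.sin u * Real.sin v * Real.sin (u + v) := by
  simp only [orient, Real.cos_add, Real.sin_add, Real.cos_two_mul, Real.sin_two_mul]
  have h1 := Real.sin_sq_add_cos_sq α
  have h2 := Real.sin_sq_add_cos_sq u
  have h3 := Real.sin_sq_add_cos_sq v
  generalize Real.sin α = a at *
  generalize Real.cos α = b at *
  generalize Real.sin u = c at *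
  generalize Real.cos u = d at *
  generalize Real.sin v = e at *
  generalize Real.cos v = f at *
  grind

lemma gonNat_orient (n : ℕ) (a b c : ℕ) (hab : a < b) (hbc : b < c) (hc : c < n) :
    0 < orient (gonNat n a) (gonNat n b) (gonNat n c) := by
  have hn : (0 : ℝ) < n := by exact_mod_cast (by omega : 0 < n)
  have hab' : (a : ℝ) < b := by exact_mod_cast hab
  have hbc' : (b : ℝ) < c := by exact_mod_cast hbc
  have hc' : (c : ℝ) < n := by exact_mod_cast hc
  have ha' : (0 : ℝ) ≤ a := by positivity
  have key := orient_circle (2 * Real.pi * a / n) (Real.pi * (b - a) / n) (Real.pi * (c - b) / n)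
  have e1 : 2 * Real.pi * a / n + 2 * (Real.pi * (b - a) / n) = 2 * Real.pi * b / n := by ring
  have e2 : 2 * Real.pi * b / n + 2 * (Real.pi * (c - b) / n) = 2 * Real.pi * c / n := by ring
  have e3 : Real.pi * (b - a) / n + (Real.pi * (c - b) / n) = Real.pi * (c - a) / n := by ring
  rw [e1, e2, e3] at key
  have hs : ∀ x : ℝ, 0 < x → x < n → 0 < Real.sin (Real.pi * x / n) := by
    intro x h0 h1
    apply Real.sin_pos_of_pos_of_lt_pi
    · have := Real.pi_pos
      positivity
    · rw [div_lt_iff₀ hn]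
      exact mul_lt_mul_of_pos_left h1 Real.pi_pos
  unfold gonNat
  rw [key]
  have s1 := hs (b - a) (by linarith) (by linarith)
  have s2 := hs (c - b) (by linarith) (by linarith)
  have s3 := hs (c - a) (by linarith) (by linarith)
  positivity

lemma ngon_cast (n k : ℕ) (hk : k < n) : ngon n (k : ZMod n) = gonNat n k := by
  unfold ngon gonNat
  rw [ZMod.val_cast_of_lt hk]

lemma range_ngon (n : ℕ) (hn : 3 ≤ n) :
    Set.range (ngon n) = (((Finset.range n).image (gonNat n) : Finset (ℝ × ℝ)) : Set (ℝ × ℝ)) := by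
  have : NeZero n := ⟨by omega⟩
  ext x
  simp only [Set.mem_range, Finset.coe_image, Finset.coe_range, Set.mem_image, Set.mem_Iio]
  constructor
  · rintro ⟨k, rfl⟩
    exact ⟨k.val, ZMod.val_lt k, rfl⟩
  · rintro ⟨k, hk, rfl⟩
    exact ⟨k, ngon_cast n k hk⟩

lemma tri_eq (n i : ℕ) (hi : i + 1 < n) :
    ({ngon n 0, ngon n (i : ZMod n), ngon n ((i : ZMod n) + 1)} : Finset (ℝ × ℝ)) =
      {gonNat n 0, gonNat n i, gonNat n (i + 1)} := by
  have h0 := ngon_cast n 0 (by omega)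
  have h1 := ngon_cast n i (by omega)
  have h2 := ngon_cast n (i + 1) hi
  push_cast at h0 h2
  rw [h0, h1, h2]

/-- The fan triangulation of the regular `n`-gon from the vertex `p 0`: the
collection of all (nonempty) subsets of the triangles `{p 0, p i, p (i+1)}`
for integers `1 ≤ i ≤ n - 2` is a simplicial complex whose underlying space
is the convex hull of the vertices of the `n`-gon. -/
theorem stmt_8 (n : ℕ) (hn : 3 ≤ n) :
    ∃ K : Geometry.SimplicialComplex ℝ (ℝ × ℝ),
      K.faces = {s : Finset (ℝ × ℝ) | s.Nonempty ∧ ∃ i : ℕ, 1 ≤ i ∧ i ≤ n - 2 ∧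
        s ⊆ ({ngon n 0, ngon n (i : ZMod n), ngon n ((i : ZMod n) + 1)} : Finset (ℝ × ℝ))} ∧
      K.space = convexHull ℝ (Set.range (ngon n)) := by
  have hq := gonNat_orient n
  refine ⟨{
    faces := {s : Finset (ℝ × ℝ) | s.Nonempty ∧ ∃ i : ℕ, 1 ≤ i ∧ i ≤ n - 2 ∧
        s ⊆ ({ngon n 0, ngon n (i : ZMod n), ngon n ((i : ZMod n) + 1)} : Finset (ℝ × ℝ))}
    isRelLowerSet_faces := ?_
    indep := ?_
    inter_subset_convexHull := ?_ }, rfl, ?_⟩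
  · rintro s ⟨hne, i, h1, h2, hs⟩
    exact ⟨hne, fun t hts ht => ⟨ht, i, h1, h2, Finset.Subset.trans hts hs⟩⟩
  · rintro s ⟨hne, i, h1, h2, hs⟩
    rw [tri_eq n i (by omega)] at hs
    exact (indep_triangle _ _ _ (hq 0 i (i + 1) (by omega) (by omega) (by omega)).ne').mono
      (by exact_mod_cast hs)
  · rintro s t ⟨_, i, h1, h2, hs⟩ ⟨_, j, h3, h4, ht⟩
    rw [tri_eq n i (by omega)] at hs
    rw [tri_eq n j (by omega)] at ht
    exact fan_inter n _ hq i j h1 (by omega) h3 (by omega) s t hs ht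
  · ext x
    rw [Geometry.SimplicialComplex.mem_space_iff]
    constructor
    · rintro ⟨s, ⟨_, i, h1, h2, hs⟩, hx⟩
      refine convexHull_mono ?_ hx
      intro y hy
      have := hs hy
      simp only [Finset.mem_insert, Finset.mem_singleton] at this
      rcases this with rfl | rfl | rfl <;> exact Set.mem_range_self _
    · intro hx
      rw [range_ngon n hn] at hx
      obtain ⟨i, h1, h2, hxi⟩ := fan_cover n _ hn hq x hx
      refine ⟨_, ⟨?_, i, h1, by omega, (tri_eq n i h2).ge⟩, hxi⟩
      simp
end

section
/- Let n ≥ 4, let p : ZMod n → ℝ² be the vertices of the regular n-gon, p k = (cos(2πk/n), sin(2πk/n)), and let S = {p k : k ∈ ZMod n}. Then for every i ∈ ZMod n: (1) convexHull ℝ S = convexHull ℝ (S \ {p i}) ∪ convexHull ℝ {p (i−1), p i, p (i+1)}; and (2) convexHull ℝ (S \ {p i}) ∩ convexHull ℝ {p (i−1), p i, p (i+1)} = segment ℝ (p (i−1)) (p (i+1)). (Cutting off the ear at vertex p i from the convex n-gon leaves the convex (n−1)-gon, the two pieces meeting exactly along the diagonal from p (i−1) to p (i+1).) -/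
lemma ear_aux {V : Type*} [AddCommGroup V] [Module ℝ V] (T : Set V) (a b c : V)
    (ha : a ∈ T) (hc : c ∈ T)
    (h : ∀ q ∈ T, ∃ l m : ℝ, 0 ≤ l ∧ 0 ≤ m ∧ 1 ≤ l + m ∧ q = b + l • (a - b) + m • (c - b))
    (f : V →ₗ[ℝ] ℝ) (t : ℝ) (hfa : f a = t) (hfc : f c = t) (hfb : t < f b) :
    convexHull ℝ (insert b T) = convexHull ℝ T ∪ convexHull ℝ ({a, b, c} : Set V) ∧
    convexHull ℝ T ∩ convexHull ℝ ({a, b, c} : Set V) = segment ℝ a c := by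
  have hseg : segment ℝ a c ⊆ convexHull ℝ T :=
    (convex_convexHull ℝ T).segment_subset (subset_convexHull ℝ T ha) (subset_convexHull ℝ T hc)
  have hconv : Convex ℝ {q : V | ∃ l m : ℝ, 0 ≤ l ∧ 0 ≤ m ∧ 1 ≤ l + m ∧
      q = b + l • (a - b) + m • (c - b)} := by
    rintro x ⟨l, m, hl, hm, hlm, rfl⟩ y ⟨l', m', hl', hm', hlm', rfl⟩ u v hu hv huv
    refine ⟨u * l + v * l', u * m + v * m', by positivity, by positivity, by nlinarith, ?_⟩
    obtain rfl : v = 1 - u := by linarith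
    module
  have hT := convexHull_min (fun q hq => h q hq) hconv
  have ha' : a ∈ convexHull ℝ ({a, b, c} : Set V) := subset_convexHull ℝ _ (by simp)
  have hb' : b ∈ convexHull ℝ ({a, b, c} : Set V) := subset_convexHull ℝ _ (by simp)
  have hc' : c ∈ convexHull ℝ ({a, b, c} : Set V) := subset_convexHull ℝ _ (by simp)
  have htri : ∀ u v w : ℝ, 0 ≤ u → 0 ≤ v → 0 ≤ w → u + v + w = 1 →
      u • a + v • b + w • c ∈ convexHull ℝ ({a, b, c} : Set V) := by
    intro u v w hu hv hw hs
    have := (convex_convexHull ℝ ({a, b, c} : Set V)).sum_mem (t := Finset.univ)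
      (w := ![u, v, w]) (z := ![a, b, c]) (by intro i _; fin_cases i <;> simpa)
      (by simpa [Fin.sum_univ_three] using hs) (by intro i _; fin_cases i <;> simpa)
    simpa [Fin.sum_univ_three] using this
  have htri' : convexHull ℝ ({a, b, c} : Set V) ⊆
      {x | ∃ u v w : ℝ, 0 ≤ u ∧ 0 ≤ v ∧ 0 ≤ w ∧ u + v + w = 1 ∧ x = u • a + v • b + w • c} := by
    apply convexHull_min
    · rintro x (rfl | rfl | rfl)
      · exact ⟨1, 0, 0, by simp⟩
      · exact ⟨0, 1, 0, by simp⟩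
      · exact ⟨0, 0, 1, by simp⟩
    · rintro x ⟨u, v, w, hu, hv, hw, hs, rfl⟩ y ⟨u', v', w', hu', hv', hw', hs', rfl⟩ r s hr hss hrs
      refine ⟨r * u + s * u', r * v + s * v', r * w + s * w', by positivity, by positivity,
        by positivity, ?_, by module⟩
      linear_combination r * hs + s * hs' + hrs
  refine ⟨Set.Subset.antisymm ?_ ?_, Set.Subset.antisymm ?_ ?_⟩
  · intro x hx
    rw [convexHull_insert ⟨a, ha⟩, convexJoin_singleton_left] at hx
    simp only [Set.mem_iUnion] at hx
    obtain ⟨y, hy, r, s, hr, hs, hrs, rfl⟩ := hx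
    obtain ⟨l, m, hl, hm, hlm, hyq⟩ := hT hy
    obtain rfl : r = 1 - s := by linarith
    by_cases hcase : s * (l + m) ≤ 1
    · right
      have := htri (s * l) (1 - s * (l + m)) (s * m) (by positivity) (by linarith) (by positivity)
        (by ring)
      convert this using 1
      rw [hyq]; module
    · left
      push Not at hcase
      have hpos : 0 < l + m := by linarith
      have hz : (l / (l + m)) • a + (m / (l + m)) • c ∈ convexHull ℝ T :=
        hseg ⟨_, _, by positivity, by positivity, by field_simp, rfl⟩
      by_cases h1 : l + m = 1
      · nlinarith
      have h2 : 0 < l + m - 1 := lt_of_le_of_ne (by linarith) (fun h => h1 (by linarith))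
      -- x = (1-w) z + w y
      have := (convex_convexHull ℝ T) hz hy (a := (1 - s) * (l + m) / (l + m - 1))
        (b := (s * (l + m) - 1) / (l + m - 1))
        (div_nonneg (mul_nonneg (by linarith) hpos.le) h2.le)
        (div_nonneg (by linarith) h2.le) (by field_simp; ring)
      convert this using 1
      rw [hyq]
      match_scalars <;> field_simp <;> ring
  · apply Set.union_subset
    · exact convexHull_mono (Set.subset_insert _ _)
    · apply convexHull_mono
      rintro x (rfl | rfl | rfl)
      · exact Or.inr ha
      · exact Or.inl rfl
      · exact Or.inr hc
  · rintro x ⟨hx, hx'⟩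
    obtain ⟨l, m, hl, hm, hlm, hxq⟩ := hT hx
    obtain ⟨u, v, w, hu, hv, hw, hs, rfl⟩ := htri' hx'
    have e := congrArg f hxq
    simp only [map_add, map_smul, map_sub, smul_eq_mul, hfa, hfc] at e
    have hv0 : v = 0 := by
      by_contra hne
      have : 0 < v := lt_of_le_of_ne hv (Ne.symm hne)
      obtain rfl : u = 1 - v - w := by linarith
      nlinarith [mul_pos this (sub_pos.2 hfb), mul_nonneg (sub_nonneg.2 hlm) (sub_pos.2 hfb).le]
    subst hv0
    exact ⟨u, w, hu, hw, by linarith, by simp⟩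
  · exact Set.subset_inter hseg ((convex_convexHull ℝ _).segment_subset ha' hc')

lemma ngon_int (n : ℕ) (hn : 4 ≤ n) (z : ℤ) :
    ngon n (z : ZMod n) = (Real.cos (2 * Real.pi / n * z), Real.sin (2 * Real.pi / n * z)) := by
  have : NeZero n := ⟨by omega⟩
  have hn0 : (n : ℝ) ≠ 0 := by positivity
  have h1 : (((z : ZMod n).val : ℤ)) = z % n := ZMod.val_intCast z
  have h2 : (((z : ZMod n).val : ℝ)) = z - n * ((z / (n : ℤ) : ℤ) : ℝ) := by
    have : (((z : ZMod n).val : ℤ)) = z - n * (z / n) := by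
      rw [h1, Int.emod_def]
    exact_mod_cast this
  have h3 : 2 * Real.pi * ((z : ZMod n).val : ℝ) / n
      = 2 * Real.pi / n * z - ((z / (n : ℤ) : ℤ) : ℝ) * (2 * Real.pi) := by
    rw [h2]; field_simp
  unfold ngon
  rw [h3, Real.cos_sub_int_mul_two_pi, Real.sin_sub_int_mul_two_pi]

lemma chord_aux (d θ : ℝ) (hd : 0 < d) (hd' : d < Real.pi) (h1 : d ≤ θ) (h2 : θ ≤ 2 * Real.pi - d) :
    ∃ l m : ℝ, 0 ≤ l ∧ 0 ≤ m ∧ 1 ≤ l + m ∧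
      Real.cos θ - 1 = (l + m) * (Real.cos d - 1) ∧ Real.sin θ = (m - l) * Real.sin d := by
  have s1 : 0 ≤ Real.sin (θ / 2) := Real.sin_nonneg_of_nonneg_of_le_pi (by linarith) (by linarith)
  have s2 : 0 ≤ Real.sin (θ / 2 + d / 2) :=
    Real.sin_nonneg_of_nonneg_of_le_pi (by linarith) (by linarith)
  have s3 : 0 ≤ Real.sin (θ / 2 - d / 2) :=
    Real.sin_nonneg_of_nonneg_of_le_pi (by linarith) (by linarith)
  have s4 : 0 < Real.sin (d / 2) := Real.sin_pos_of_pos_of_lt_pi (by linarith) (by linarith)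
  have c4 : 0 < Real.cos (d / 2) := Real.cos_pos_of_mem_Ioo ⟨by linarith, by linarith⟩
  have e1 : Real.cos θ = 1 - 2 * Real.sin (θ / 2) ^ 2 := by
    rw [show θ = 2 * (θ / 2) by ring, Real.cos_two_mul, Real.cos_sq']; ring_nf
  have e2 : Real.cos d = 1 - 2 * Real.sin (d / 2) ^ 2 := by
    rw [show d = 2 * (d / 2) by ring, Real.cos_two_mul, Real.cos_sq']; ring_nf
  have e3 : Real.sin θ = 2 * Real.sin (θ / 2) * Real.cos (θ / 2) := by
    rw [← Real.sin_two_mul]; ring_nf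
  have e4 : Real.sin d = 2 * Real.sin (d / 2) * Real.cos (d / 2) := by
    rw [← Real.sin_two_mul]; ring_nf
  have e5 := Real.sin_add (θ / 2) (d / 2)
  have e6 := Real.sin_sub (θ / 2) (d / 2)
  have key : Real.sin (θ / 2) * Real.sin (θ / 2 - d / 2) / (2 * Real.sin (d / 2) ^ 2 * Real.cos (d / 2))
      + Real.sin (θ / 2) * Real.sin (θ / 2 + d / 2) / (2 * Real.sin (d / 2) ^ 2 * Real.cos (d / 2))
      = Real.sin (θ / 2) ^ 2 / Real.sin (d / 2) ^ 2 := by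
    rw [e5, e6]; field_simp; ring
  refine ⟨Real.sin (θ / 2) * Real.sin (θ / 2 - d / 2) / (2 * Real.sin (d / 2) ^ 2 * Real.cos (d / 2)),
    Real.sin (θ / 2) * Real.sin (θ / 2 + d / 2) / (2 * Real.sin (d / 2) ^ 2 * Real.cos (d / 2)),
    by positivity, by positivity, ?_, ?_, ?_⟩
  · rw [key, one_le_div (by positivity)]
    have : Real.cos θ ≤ Real.cos d := by
      rcases le_total θ Real.pi with h | h
      · exact Real.cos_le_cos_of_nonneg_of_le_pi hd.le h h1
      · rw [← Real.cos_two_pi_sub θ]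
        exact Real.cos_le_cos_of_nonneg_of_le_pi hd.le (by linarith) (by linarith)
    linarith
  · rw [key, e1, e2]; field_simp; ring
  · rw [e3, e4, e5, e6]; field_simp; ring

theorem stmt_9 (n : ℕ) (hn : 4 ≤ n) (i : ZMod n) (S : Set (ℝ × ℝ))
    (hS : S = Set.range (ngon n)) :
    convexHull ℝ S =
      convexHull ℝ (S \ {ngon n i}) ∪
        convexHull ℝ ({ngon n (i - 1), ngon n i, ngon n (i + 1)} : Set (ℝ × ℝ)) ∧
    convexHull ℝ (S \ {ngon n i}) ∩
        convexHull ℝ ({ngon n (i - 1), ngon n i, ngon n (i + 1)} : Set (ℝ × ℝ)) =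
      segment ℝ (ngon n (i - 1)) (ngon n (i + 1)) := by
  have : NeZero n := ⟨by omega⟩
  have hn4 : (4 : ℝ) ≤ n := by exact_mod_cast hn
  have hpi := Real.pi_pos
  obtain ⟨d, hd⟩ : ∃ d : ℝ, d = 2 * Real.pi / n := ⟨_, rfl⟩
  have hdn : d * n = 2 * Real.pi := by rw [hd]; field_simp
  have hd0 : 0 < d := by rw [hd]; positivity
  have hd1 : d < Real.pi := by nlinarith
  obtain ⟨φ, hφ⟩ : ∃ φ : ℝ, φ = d * i.val := ⟨_, rfl⟩
  have hk : ∀ m : ℤ, ngon n (i + m) = (Real.cos (φ + d * m), Real.sin (φ + d * m)) := by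
    intro m
    have : i + (m : ZMod n) = ((i.val + m : ℤ) : ZMod n) := by push_cast; simp
    rw [this, ngon_int n hn, ← hd, hφ]
    push_cast
    rw [mul_add]
  have hb : ngon n i = (Real.cos φ, Real.sin φ) := by simpa using hk 0
  have ha : ngon n (i - 1) = (Real.cos (φ - d), Real.sin (φ - d)) := by
    have := hk (-1)
    simpa [← sub_eq_add_neg] using this
  have hc : ngon n (i + 1) = (Real.cos (φ + d), Real.sin (φ + d)) := by simpa using hk 1
  have hcs := Real.sin_sq_add_cos_sq φ
  have hcd : Real.cos d < 1 := by
    rw [← Real.cos_zero]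
    exact Real.cos_lt_cos_of_nonneg_of_le_pi le_rfl hd1.le hd0
  let f : ℝ × ℝ →ₗ[ℝ] ℝ :=
    Real.cos φ • LinearMap.fst ℝ ℝ ℝ + Real.sin φ • LinearMap.snd ℝ ℝ ℝ
  have hf : ∀ x, f x = Real.cos φ * x.1 + Real.sin φ * x.2 := fun x => by simp [f]
  have hfb : f (ngon n i) = 1 := by rw [hf, hb]; simp only; nlinarith
  have hfa : f (ngon n (i - 1)) = Real.cos d := by
    rw [hf, ha]; simp only [Real.cos_sub, Real.sin_sub]
    linear_combination Real.cos d * hcs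
  have hfc : f (ngon n (i + 1)) = Real.cos d := by
    rw [hf, hc]; simp only [Real.cos_add, Real.sin_add]
    linear_combination Real.cos d * hcs
  have main := ear_aux (S \ {ngon n i}) (ngon n (i - 1)) (ngon n i) (ngon n (i + 1))
    ⟨by rw [hS]; exact ⟨_, rfl⟩, fun h => by
      rw [Set.mem_singleton_iff] at h; rw [h] at hfa; linarith⟩
    ⟨by rw [hS]; exact ⟨_, rfl⟩, fun h => by
      rw [Set.mem_singleton_iff] at h; rw [h] at hfc; linarith⟩
    ?_ f (Real.cos d) hfa hfc (by linarith)
  · have hi : insert (ngon n i) (S \ {ngon n i}) = S := by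
      rw [Set.insert_sdiff_singleton, Set.insert_eq_of_mem]
      rw [hS]; exact ⟨_, rfl⟩
    rwa [hi] at main
  · rintro q ⟨hq, hqi⟩
    rw [hS] at hq
    obtain ⟨k, rfl⟩ := hq
    have hne : k - i ≠ 0 := fun h => hqi (by rw [sub_eq_zero.1 h]; rfl)
    have hm1 : 1 ≤ (k - i).val := by
      have := (ZMod.val_ne_zero (k - i)).2 hne
      omega
    have hm2 : (k - i).val + 1 ≤ n := ZMod.val_lt (k - i)
    have hkk : k = i + (((k - i).val : ℤ) : ZMod n) := by simp
    have hq := hk ((k - i).val : ℤ)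
    rw [← hkk] at hq
    generalize (k - i).val = m at *
    have hm1' : (1 : ℝ) ≤ m := by exact_mod_cast hm1
    have hm2' : (m : ℝ) + 1 ≤ n := by exact_mod_cast hm2
    obtain ⟨l, u, hl, hu, hlu, h1, h2⟩ := chord_aux d (d * m) hd0 hd1 (by nlinarith) (by nlinarith)
    refine ⟨l, u, hl, hu, hlu, ?_⟩
    rw [hq, ha, hb, hc]
    ext
    · simp [Real.cos_add, Real.cos_sub]
      linear_combination Real.cos φ * h1 - Real.sin φ * h2
    · simp [Real.sin_add, Real.sin_sub]
      linear_combination Real.sin φ * h1 + Real.cos φ * h2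
end
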